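/- There is no ternary permutation of the nonzero elements of (ℤ/2ℤ)^4; that is, (ℤ/2ℤ)^4 is not sequentially ternary. -/

import Mathlib

def SeqTernary (n : ℕ) : Prop :=
  ∃ v : ℕ → (Fin n → ZMod 2),
    Set.BijOn v (Set.Icc 1 (2 ^ n - 1)) {x | x ≠ 0} ∧
    ∀ i : ℕ, 2 ≤ i → i ≤ 2 ^ n - 2 → Even i → v (i - 1) + v i + v (i + 1) = 0

/-- No way to extend a partial sequence (last odd-position entry `l`, used values `u`)
by `k` further pairs. -/
def dead : ℕ → ℕ → List ℕ → Bool
  | 0, _, _ => false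
  | k + 1, l, u => (List.range 16).all fun c =>
      u.contains c || (u.contains (l ^^^ c) || dead k c (c :: (l ^^^ c) :: u))

theorem dead_sound (w : ℕ → ℕ) (hlt : ∀ i, w i < 16)
    (hinj : ∀ i j, i ≤ 15 → j ≤ 15 → w i = w j → i = j)
    (hx : ∀ j, j < 7 → w (2 * j + 2) = w (2 * j + 1) ^^^ w (2 * j + 3)) :
    ∀ k j u, k + j = 7 → (∀ x ∈ u, ∃ i, i ≤ 2 * j + 1 ∧ w i = x) →
      dead k (w (2 * j + 1)) u = true → False := by
  intro k
  induction k with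
  | zero => intro j u _ _ h; simp [dead] at h
  | succ k ih =>
    intro j u hk hu h
    rw [dead, List.all_eq_true] at h
    have h1 := h (w (2 * j + 3)) (List.mem_range.2 (hlt _))
    rw [← hx j (by omega)] at h1
    simp only [Bool.or_eq_true, List.contains_iff_mem] at h1
    rcases h1 with h1 | h1 | h1
    · obtain ⟨i, hi, he⟩ := hu _ h1
      have := hinj _ _ (by omega) (by omega) he
      omega
    · obtain ⟨i, hi, he⟩ := hu _ h1
      have := hinj _ _ (by omega) (by omega) he
      omega
    · refine ih (j + 1) _ (by omega) ?_ h1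
      intro x hx'
      simp only [List.mem_cons] at hx'
      rcases hx' with rfl | rfl | hx'
      · exact ⟨2 * j + 3, by omega, rfl⟩
      · exact ⟨2 * j + 2, by omega, rfl⟩
      · obtain ⟨i, hi, he⟩ := hu _ hx'
        exact ⟨i, by omega, he⟩

theorem dead_start : dead 5 4 [0, 1, 3, 2, 6, 4] = true := by decide +kernel

/-- Binary code of a vector. -/
def enc (x : Fin 4 → ZMod 2) : ℕ :=
  (x 0).val + 2 * (x 1).val + 4 * (x 2).val + 8 * (x 3).val

theorem enc_lt (x : Fin 4 → ZMod 2) : enc x < 16 := by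
  have h : ∀ a : ZMod 2, a.val < 2 := fun a => ZMod.val_lt a
  have := h (x 0); have := h (x 1); have := h (x 2); have := h (x 3)
  unfold enc; omega

theorem enc_inj : Function.Injective enc := by
  intro x y hxy
  have h : ∀ a : ZMod 2, a.val < 2 := fun a => ZMod.val_lt a
  have := h (x 0); have := h (x 1); have := h (x 2); have := h (x 3)
  have := h (y 0); have := h (y 1); have := h (y 2); have := h (y 3)
  unfold enc at hxy
  funext i
  apply ZMod.val_injective
  fin_cases i <;> simp <;> omega

theorem enc_add (x y : Fin 4 → ZMod 2) : enc (x + y) = enc x ^^^ enc y := by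
  have key : ∀ a b c d a' b' c' d' : ZMod 2,
      (a + a').val + 2 * (b + b').val + 4 * (c + c').val + 8 * (d + d').val =
      (a.val + 2 * b.val + 4 * c.val + 8 * d.val) ^^^
      (a'.val + 2 * b'.val + 4 * c'.val + 8 * d'.val) := by decide +kernel
  exact key _ _ _ _ _ _ _ _

theorem zz (a : ZMod 2) : a = 0 ∨ a = 1 := by revert a; decide

theorem add_self2 (x : Fin 4 → ZMod 2) : x + x = 0 := by
  funext i
  exact CharTwo.add_self_eq_zero (x i)

theorem exists_outside (p q r : Fin 4 → ZMod 2) :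
    ∃ w, ∀ a b c : ZMod 2, w ≠ a • p + b • q + c • r := by
  by_contra! h
  have hs : Function.Surjective
      (fun t : ZMod 2 × ZMod 2 × ZMod 2 => t.1 • p + t.2.1 • q + t.2.2 • r) := by
    intro w
    obtain ⟨a, b, c, e⟩ := h w
    exact ⟨(a, b, c), e.symm⟩
  have := Fintype.card_le_of_surjective _ hs
  simp at this

theorem exists_equiv (p q r : Fin 4 → ZMod 2) (hp : p ≠ 0) (hq : q ≠ 0) (hr : r ≠ 0)
    (hpq : p ≠ q) (hpr : p ≠ r) (hqr : q ≠ r) (hs : p + q ≠ r) :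
    ∃ f : (Fin 4 → ZMod 2) → (Fin 4 → ZMod 2), Function.Injective f ∧
      (∀ x y, f (x + y) = f x + f y) ∧ enc (f p) = 1 ∧ enc (f q) = 2 ∧ enc (f r) = 4 := by
  obtain ⟨w, hw⟩ := exists_outside p q r
  let g : (Fin 4 → ZMod 2) →ₗ[ZMod 2] (Fin 4 → ZMod 2) :=
    Fintype.linearCombination (ZMod 2) ![p, q, r, w]
  have hg : ∀ x, g x = x 0 • p + x 1 • q + x 2 • r + x 3 • w := by
    intro x
    simp [g, Fintype.linearCombination_apply, Fin.sum_univ_four]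
  have eq_of : ∀ x y : Fin 4 → ZMod 2, x + y = 0 → x = y := by
    intro x y h
    have := add_self2 y
    exact add_right_cancel (h.trans this.symm)
  have hinj : Function.Injective g := by
    rw [injective_iff_map_eq_zero]
    intro x hx
    rw [hg] at hx
    have h3 : x 3 = 0 := by
      rcases zz (x 3) with h | h
      · exact h
      · exfalso
        rw [h, one_smul] at hx
        exact hw _ _ _ (eq_of _ _ hx).symm
    rw [h3, zero_smul, add_zero] at hx
    have : x 0 = 0 ∧ x 1 = 0 ∧ x 2 = 0 := by
      rcases zz (x 0) with h0 | h0 <;> rcases zz (x 1) with h1 | h1 <;>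
        rcases zz (x 2) with h2 | h2 <;> rw [h0, h1, h2] at hx <;>
        simp only [zero_smul, one_smul, zero_add, add_zero] at hx
      · exact ⟨h0, h1, h2⟩
      · exact absurd hx hr
      · exact absurd hx hq
      · exact absurd (eq_of _ _ hx) hqr
      · exact absurd hx hp
      · exact absurd (eq_of _ _ hx) hpr
      · exact absurd (eq_of _ _ hx) hpq
      · exact absurd (eq_of _ _ hx) hs
    funext i
    fin_cases i
    · exact this.1
    · exact this.2.1
    · exact this.2.2
    · exact h3
  let e := LinearEquiv.ofInjectiveEndo g hinj
  have he : ∀ x, e x = g x := fun x => rfl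
  have hsy : ∀ x y, g x = y → e.symm y = x := by
    intro x y h
    rw [← h, ← he, LinearEquiv.symm_apply_apply]
  refine ⟨e.symm, e.symm.injective, fun x y => map_add _ _ _, ?_, ?_, ?_⟩
  · rw [hsy ![1, 0, 0, 0] p (by simp [hg])]; decide
  · rw [hsy ![0, 1, 0, 0] q (by simp [hg])]; decide
  · rw [hsy ![0, 0, 1, 0] r (by simp [hg])]; decide

theorem stmt3 : ¬ SeqTernary 4 := by
  rintro ⟨v, hb, ht⟩
  norm_num at hb ht
  have hne : ∀ i, 1 ≤ i → i ≤ 15 → v i ≠ 0 := fun i h1 h2 => hb.mapsTo ⟨h1, h2⟩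
  have hvi : ∀ i j, 1 ≤ i → i ≤ 15 → 1 ≤ j → j ≤ 15 → v i = v j → i = j :=
    fun i j h1 h2 h3 h4 h => hb.injOn ⟨h1, h2⟩ ⟨h3, h4⟩ h
  have hd : ∀ j, j < 7 → v (2 * j + 2) = v (2 * j + 1) + v (2 * j + 3) := by
    intro j hj
    have h := ht (2 * j + 2) (by omega) (by omega) ⟨j + 1, by ring⟩
    have e1 : 2 * j + 2 - 1 = 2 * j + 1 := by omega
    rw [e1] at h
    have h2 : v (2 * j + 2) + (v (2 * j + 1) + v (2 * j + 3)) = 0 := by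
      rw [← h]; abel
    exact add_right_cancel (h2.trans (add_self2 _).symm)
  obtain ⟨f, fi, fa, f1, f2, f3⟩ := exists_equiv (v 1) (v 3) (v 5)
    (hne _ (by omega) (by omega)) (hne _ (by omega) (by omega)) (hne _ (by omega) (by omega))
    (fun h => by have := hvi _ _ (by omega) (by omega) (by omega) (by omega) h; omega)
    (fun h => by have := hvi _ _ (by omega) (by omega) (by omega) (by omega) h; omega)
    (fun h => by have := hvi _ _ (by omega) (by omega) (by omega) (by omega) h; omega)
    (fun h => by
      have h0 := hd 0 (by omega)
      have := hvi 2 5 (by omega) (by omega) (by omega) (by omega) (h0.trans h)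
      omega)
  have f0 : f 0 = 0 := by
    have := fa 0 0
    rw [add_zero] at this
    simpa using this
  let w : ℕ → ℕ := fun i => if i = 0 then 0 else enc (f (v i))
  have e0 : enc 0 = 0 := by decide
  have w0 : w 0 = 0 := rfl
  have ws : ∀ i, 1 ≤ i → w i = enc (f (v i)) := fun i hi => if_neg (by omega)
  have wne : ∀ i, 1 ≤ i → i ≤ 15 → w i ≠ 0 := by
    intro i h1 h2 h
    rw [ws i h1, ← e0, ← f0] at h
    exact hne i h1 h2 (fi (enc_inj h))
  have hx : ∀ j, j < 7 → w (2 * j + 2) = w (2 * j + 1) ^^^ w (2 * j + 3) := by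
    intro j hj
    rw [ws _ (by omega), ws _ (by omega), ws _ (by omega), hd j hj, fa, enc_add]
  have w1 : w 1 = 1 := f1
  have w3 : w 3 = 2 := f2
  have w5 : w 5 = 4 := f3
  have w2 : w 2 = 3 := by
    have := hx 0 (by omega); simp only [Nat.mul_zero, Nat.zero_add] at this
    rw [this, w1, w3]; rfl
  have w4 : w 4 = 6 := by
    have := hx 1 (by omega); simp only [Nat.mul_one, Nat.reduceAdd] at this
    rw [this, w3, w5]; rfl
  refine dead_sound w ?_ ?_ hx 5 2 [0, 1, 3, 2, 6, 4] rfl ?_ ?_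
  · intro i
    rcases Nat.eq_zero_or_pos i with rfl | h
    · rw [w0]; omega
    · rw [ws i h]; exact enc_lt _
  · intro i j hi hj h
    rcases Nat.eq_zero_or_pos i with rfl | hi0
    · rcases Nat.eq_zero_or_pos j with rfl | hj0
      · rfl
      · exact absurd h.symm (wne j hj0 hj)
    · rcases Nat.eq_zero_or_pos j with rfl | hj0
      · exact absurd h (wne i hi0 hi)
      · rw [ws i hi0, ws j hj0] at h
        exact hvi i j hi0 hi hj0 hj (fi (enc_inj h))
  · intro x hx'
    simp only [List.mem_cons, List.not_mem_nil, or_false] at hx'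
    rcases hx' with rfl | rfl | rfl | rfl | rfl | rfl
    · exact ⟨0, by omega, w0⟩
    · exact ⟨1, by omega, w1⟩
    · exact ⟨2, by omega, w2⟩
    · exact ⟨3, by omega, w3⟩
    · exact ⟨4, by omega, w4⟩
    · exact ⟨5, by omega, w5⟩
  · show dead 5 (w 5) _ = true
    rw [w5]; exact dead_start
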